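/- arXiv:1810.10899 — 2 statements merged into one kernel-verified Lean document; each statement's English description precedes it below -/
import Mathlib

section
/- Let I and n be positive integers, let A be an I × n matrix with integer entries, let b be an integer vector of length I, and let C ≥ 1 be an integer such that the absolute value of every entry of A and of b is at most C. If the system of I linear inequalities A·x ≥ b has a solution x ∈ ℕⁿ, then it has a solution x ∈ ℕⁿ in which the number of indices j with x_j ≠ 0 is at most 2·I·log₂(2·C·√I). -/
open Finset in
lemma aux_second_moment {ι : Type*} [DecidableEq ι] (a : ι → ℝ) (S : Finset ι) :
    ∑ T ∈ S.powerset, (∑ j ∈ T, a j - (∑ j ∈ S, a j) / 2) ^ 2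
      = 2 ^ S.card * ((∑ j ∈ S, a j ^ 2) / 4) := by
  induction S using Finset.induction_on with
  | empty => simp
  | insert k S hk ih =>
    rw [Finset.sum_powerset_insert hk, ← Finset.sum_add_distrib, Finset.card_insert_of_notMem hk]
    have h : ∀ T ∈ S.powerset,
        (∑ j ∈ T, a j - (∑ j ∈ insert k S, a j) / 2) ^ 2
          + (∑ j ∈ insert k T, a j - (∑ j ∈ insert k S, a j) / 2) ^ 2
        = 2 * (∑ j ∈ T, a j - (∑ j ∈ S, a j) / 2) ^ 2 + a k ^ 2 / 2 := by
      intro T hT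
      have hkT : k ∉ T := fun h => hk (Finset.mem_powerset.1 hT h)
      rw [Finset.sum_insert hk, Finset.sum_insert hkT]
      ring
    rw [Finset.sum_congr rfl h, Finset.sum_add_distrib, ← Finset.mul_sum, ih,
      Finset.sum_insert hk, Finset.sum_const, Finset.card_powerset, nsmul_eq_mul]
    push_cast
    ring

lemma aux_collision_range {ι : Type*} [DecidableEq ι] (I : ℕ) (A : Fin I → ι → ℤ)
    (S : Finset ι) (hA : ∀ i j, |A i j| ≤ 1) (h : (S.card + 1) ^ I < 2 ^ S.card) :
    ∃ T ∈ S.powerset, ∃ T' ∈ S.powerset, T ≠ T' ∧ ∀ i, ∑ j ∈ T, A i j = ∑ j ∈ T', A i j := by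
  classical
  let B : Finset (Fin I → ℤ) := Fintype.piFinset fun i =>
    Finset.Icc (∑ j ∈ S, min (A i j) 0) (∑ j ∈ S, max (A i j) 0)
  have hB : B.card ≤ (S.card + 1) ^ I := by
    rw [Fintype.card_piFinset]
    calc _ ≤ ∏ _i : Fin I, (S.card + 1) := by
          apply Finset.prod_le_prod' 
          intro i _
          rw [Int.card_Icc]
          have : ∑ j ∈ S, max (A i j) 0 - ∑ j ∈ S, min (A i j) 0 ≤ S.card := by
            rw [← Finset.sum_sub_distrib]
            calc _ ≤ ∑ j ∈ S, (1 : ℤ) := by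
                  apply Finset.sum_le_sum
                  intro j _
                  have := abs_le.1 (hA i j)
                  omega
              _ = _ := by simp
          omega
      _ = _ := by simp
  have hc : B.card < S.powerset.card := by
    rw [Finset.card_powerset]; omega
  obtain ⟨T, hT, T', hT', hne, heq⟩ := Finset.exists_ne_map_eq_of_card_lt_of_maps_to hc
    (f := fun T i => ∑ j ∈ T, A i j) (by
      intro T hT
      have hT := Finset.mem_powerset.1 hT
      simp only [B, Finset.mem_coe, Fintype.mem_piFinset, Finset.mem_Icc]
      intro i
      constructor
      · calc _ ≤ ∑ j ∈ T, min (A i j) 0 := by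
              rw [← Finset.sum_sdiff hT]
              have : ∑ j ∈ S \ T, min (A i j) 0 ≤ 0 :=
                Finset.sum_nonpos fun j _ => min_le_right _ _
              omega
          _ ≤ _ := Finset.sum_le_sum fun j _ => min_le_left _ _
      · calc _ ≤ ∑ j ∈ T, max (A i j) 0 := Finset.sum_le_sum fun j _ => le_max_left _ _
          _ ≤ _ := by
              rw [← Finset.sum_sdiff hT]
              have : 0 ≤ ∑ j ∈ S \ T, max (A i j) 0 :=
                Finset.sum_nonneg fun j _ => le_max_right _ _
              omega)
  exact ⟨T, hT, T', hT', hne, fun i => congrFun heq i⟩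

lemma aux_arctan (u : ℝ) (hu : 0 ≤ u) : u / (1 + u ^ 2) ≤ Real.arctan u := by
  have h1 : Real.sin (Real.arctan u) ≤ Real.arctan u := Real.sin_le (Real.arctan_nonneg.2 hu)
  rw [Real.sin_arctan] at h1
  refine le_trans ?_ h1
  apply div_le_div_of_nonneg_left hu (by positivity)
  rw [Real.sqrt_le_left (by positivity)]
  nlinarith [sq_nonneg u]

lemma aux_term (s x : ℝ) (hs : 0 < s) (hs2 : 5 / 4 ≤ s ^ 2) :
    1 / (s ^ 2 + x ^ 2 + 1) ≤
      1 / s * (Real.arctan ((x + 1 / 2) / s) - Real.arctan ((x - 1 / 2) / s)) := by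
  have hw : 0 < s ^ 2 + x ^ 2 - 1 / 4 := by nlinarith [sq_nonneg x]
  have h1 : Real.arctan ((x + 1 / 2) / s) - Real.arctan ((x - 1 / 2) / s)
      = Real.arctan (s / (s ^ 2 + x ^ 2 - 1 / 4)) := by
    rw [sub_eq_add_neg, ← Real.arctan_neg, Real.arctan_add]
    · congr 1
      have : 1 - (x + 1 / 2) / s * -((x - 1 / 2) / s) = (s ^ 2 + x ^ 2 - 1 / 4) / s ^ 2 := by
        field_simp; ring
      rw [this]
      field_simp
      ring
    · have : 1 - (x + 1 / 2) / s * -((x - 1 / 2) / s) = (s ^ 2 + x ^ 2 - 1 / 4) / s ^ 2 := by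
        field_simp; ring
      have h2 : 0 < (s ^ 2 + x ^ 2 - 1 / 4) / s ^ 2 := by positivity
      linarith
  rw [h1]
  set w := s ^ 2 + x ^ 2 - 1 / 4 with hwdef
  have h2 := aux_arctan (s / w) (by positivity)
  calc 1 / (s ^ 2 + x ^ 2 + 1) ≤ 1 / s * (s / w / (1 + (s / w) ^ 2)) := by
        have : 1 / s * (s / w / (1 + (s / w) ^ 2)) = w / (w ^ 2 + s ^ 2) := by
          field_simp
        rw [this, div_le_div_iff₀ (by positivity) (by positivity)]
        nlinarith [sq_nonneg x]
    _ ≤ _ := by gcongr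

lemma aux_cauchy_sum (s μ : ℝ) (hs : 0 < s) (hs2 : 5 / 4 ≤ s ^ 2) (F : Finset ℤ) :
    ∑ k ∈ F, 1 / (s ^ 2 + ((k : ℝ) - μ) ^ 2 + 1) ≤ Real.pi / s := by
  classical
  obtain ⟨M, hM⟩ : ∃ M : ℕ, ∀ k ∈ F, |k| ≤ M := by
    refine ⟨∑ k ∈ F, k.natAbs, fun k hk => ?_⟩
    have := Finset.single_le_sum (f := fun k : ℤ => k.natAbs) (fun _ _ => Nat.zero_le _) hk
    rw [Int.abs_eq_natAbs]
    exact_mod_cast this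
  have hsub : F ⊆ (Finset.range (2 * M + 1)).image (fun j : ℕ => (j : ℤ) - M) := by
    intro k hk
    have := abs_le.1 (hM k hk)
    refine Finset.mem_image.2 ⟨(k + M).toNat, ?_, ?_⟩
    · rw [Finset.mem_range]; omega
    · omega
  have hpos : ∀ y : ℝ, 0 < s ^ 2 + y ^ 2 + 1 := fun y => by positivity
  refine (Finset.sum_le_sum_of_subset_of_nonneg hsub
    (fun k _ _ => (one_div_pos.2 (hpos _)).le)).trans ?_
  rw [Finset.sum_image (by intro a _ b _ h; simpa using h)]
  let g : ℕ → ℝ := fun j => 1 / s * Real.arctan (((j : ℝ) - M - μ - 1 / 2) / s)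
  calc _ ≤ ∑ j ∈ Finset.range (2 * M + 1), (g (j + 1) - g j) := by
        apply Finset.sum_le_sum
        intro j _
        have := aux_term s ((j : ℝ) - M - μ) hs hs2
        simp only [g]
        push_cast
        rw [← mul_sub]
        have e : (j : ℝ) + 1 - M - μ - 1 / 2 = j - M - μ + 1 / 2 := by ring
        rw [e]
        exact this
    _ = g (2 * M + 1) - g 0 := Finset.sum_range_sub _ _
    _ ≤ _ := by
        simp only [g]
        rw [← mul_sub]
        have h1 := Real.arctan_lt_pi_div_two (((2 * M + 1 : ℕ) - M - μ - 1 / 2) / s)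
        have h2 := Real.neg_pi_div_two_lt_arctan (((0 : ℕ) - M - μ - 1 / 2) / s)
        have e : Real.pi / s = 1 / s * Real.pi := by ring
        rw [e]
        exact mul_le_mul_of_nonneg_left (by linarith) (one_div_pos.2 hs).le

lemma aux_entropy {ι : Type*} [DecidableEq ι] (I : ℕ) (A : Fin I → ι → ℤ)
    (S : Finset ι) (C : ℝ) (hA : ∀ i j, |(A i j : ℝ)| ≤ C) (s : ℝ) (hs : 0 < s)
    (hs2 : 5 / 4 ≤ s ^ 2) (hsC : s ^ 2 = S.card * C ^ 2 / 4)
    (hinj : ∀ T ∈ S.powerset, ∀ T' ∈ S.powerset,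
      (∀ i, ∑ j ∈ T, A i j = ∑ j ∈ T', A i j) → T = T') :
    (2 : ℝ) ^ S.card ≤ (Real.pi / s * (2 * s ^ 2 + 1)) ^ I := by
  classical
  set M : ℝ := 2 * s ^ 2 + 1 with hM
  have hMpos : 0 < M := by positivity
  let μ : Fin I → ℝ := fun i => (∑ j ∈ S, (A i j : ℝ)) / 2
  let q : Fin I → ℤ → ℝ := fun i k => s ^ 2 + ((k : ℝ) - μ i) ^ 2 + 1
  have hq : ∀ i k, 0 < q i k := fun i k => by simp only [q]; positivity
  let f : Finset ι → Fin I → ℤ := fun T i => ∑ j ∈ T, A i j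
  have hfinj : Set.InjOn f (S.powerset : Set (Finset ι)) := by
    intro T hT T' hT' h
    exact hinj T hT T' hT' (fun i => congrFun h i)
  -- upper bound
  have hup : ∑ T ∈ S.powerset, ∏ i, 1 / q i (f T i) ≤ (Real.pi / s) ^ I := by
    rw [← Finset.sum_image (f := fun v : Fin I → ℤ => ∏ i, 1 / q i (v i)) hfinj]
    have hsub : S.powerset.image f ⊆
        Fintype.piFinset (fun i => S.powerset.image (fun T => f T i)) := by
      intro v hv
      obtain ⟨T, hT, rfl⟩ := Finset.mem_image.1 hv
      rw [Fintype.mem_piFinset]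
      exact fun i => Finset.mem_image.2 ⟨T, hT, rfl⟩
    refine (Finset.sum_le_sum_of_subset_of_nonneg hsub
      (fun v _ _ => Finset.prod_nonneg fun i _ => (one_div_pos.2 (hq _ _)).le)).trans ?_
    rw [← Finset.prod_univ_sum (fun i => S.powerset.image (fun T => f T i))
      (fun i k => 1 / q i k)]
    calc _ ≤ ∏ _i : Fin I, Real.pi / s := by
          apply Finset.prod_le_prod
          · intro i _
            exact Finset.sum_nonneg fun k _ => (one_div_pos.2 (hq _ _)).le
          · intro i _
            exact aux_cauchy_sum s (μ i) hs hs2 _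
      _ = _ := by rw [Finset.prod_const, Finset.card_univ, Fintype.card_fin]
  -- pointwise lower bound
  have hpt : ∀ T, (1 / M) ^ I * (1 + I - ∑ i, q i (f T i) / M) ≤ ∏ i, 1 / q i (f T i) := by
    intro T
    have h1 : ∀ i, 1 / M * Real.exp (1 - q i (f T i) / M) ≤ 1 / q i (f T i) := by
      intro i
      have h2 := Real.add_one_le_exp (q i (f T i) / M - 1)
      have h3 : q i (f T i) / M ≤ Real.exp (q i (f T i) / M - 1) := by linarith
      have h4 : (0 : ℝ) < q i (f T i) / M := div_pos (hq _ _) hMpos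
      have h5 : Real.exp (1 - q i (f T i) / M) = 1 / Real.exp (q i (f T i) / M - 1) := by
        rw [one_div, ← Real.exp_neg]; ring_nf
      rw [h5]
      calc _ ≤ 1 / M * (1 / (q i (f T i) / M)) := by gcongr
        _ = _ := by
          have := (hq i (f T i)).ne'
          field_simp
    calc _ ≤ (1 / M) ^ I * Real.exp (∑ i, (1 - q i (f T i) / M)) := by
          gcongr
          have := Real.add_one_le_exp (∑ i, (1 - q i (f T i) / M))
          rw [Finset.sum_sub_distrib] at this ⊢
          simp at this ⊢
          linarith
      _ = ∏ i, (1 / M * Real.exp (1 - q i (f T i) / M)) := by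
          rw [Finset.prod_mul_distrib, Real.exp_sum]; simp
      _ ≤ _ := Finset.prod_le_prod (fun i _ => by positivity) (fun i _ => h1 i)
  have hmom : ∀ i, ∑ T ∈ S.powerset, q i (f T i) ≤ 2 ^ S.card * M := by
    intro i
    have h1 := aux_second_moment (fun j => (A i j : ℝ)) S
    have h2 : ∑ j ∈ S, (A i j : ℝ) ^ 2 ≤ S.card * C ^ 2 := by
      calc _ ≤ ∑ j ∈ S, C ^ 2 := by
            apply Finset.sum_le_sum
            intro j _
            rw [← sq_abs]
            gcongr
            exact hA i j
        _ = _ := by simp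
    have h3 : ∑ T ∈ S.powerset, q i (f T i) = 2 ^ S.card * (s ^ 2 + 1) +
        ∑ T ∈ S.powerset, (∑ j ∈ T, (A i j : ℝ) - (∑ j ∈ S, (A i j : ℝ)) / 2) ^ 2 := by
      simp only [q, f, μ]
      push_cast
      rw [Finset.sum_add_distrib, Finset.sum_add_distrib]
      simp
      ring
    rw [h3, h1, ← mul_add]
    gcongr
    linarith
  have hlow : (1 / M) ^ I * 2 ^ S.card ≤ ∑ T ∈ S.powerset, ∏ i, 1 / q i (f T i) := by
    refine le_trans ?_ (Finset.sum_le_sum fun T _ => hpt T)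
    rw [← Finset.mul_sum]
    gcongr
    rw [Finset.sum_sub_distrib, Finset.sum_comm]
    have : ∑ i, ∑ T ∈ S.powerset, q i (f T i) / M ≤ ∑ _i : Fin I, (2 : ℝ) ^ S.card := by
      apply Finset.sum_le_sum
      intro i _
      rw [← Finset.sum_div, div_le_iff₀ hMpos]
      exact hmom i
    simp at this ⊢
    linarith
  have := hlow.trans hup
  rw [mul_pow]
  rw [one_div, inv_pow, inv_mul_le_iff₀ (by positivity)] at this
  linarith

lemma aux_numeric (I n : ℕ) (hI : 0 < I) (C s : ℝ) (hs : 0 < s)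
    (hsC : s ^ 2 = n * C ^ 2 / 4) (hT : 16 ≤ 4 * C ^ 2 * I) (hs4 : 4 ≤ s ^ 2)
    (hn : (4 * C ^ 2 * I) ^ I < (2 : ℝ) ^ n)
    (h : (2 : ℝ) ^ n ≤ (Real.pi / s * (2 * s ^ 2 + 1)) ^ I) : False := by
  have hIr : (0 : ℝ) < I := by exact_mod_cast hI
  set u : ℝ := n / I with hu
  set r : ℝ := (2 : ℝ) ^ u with hr
  have hrI : r ^ I = (2 : ℝ) ^ n := by
    rw [hr, ← Real.rpow_natCast, ← Real.rpow_mul (by norm_num), hu,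
      div_mul_cancel₀ _ hIr.ne', Real.rpow_natCast]
  have hrpos : 0 < r := by positivity
  rw [← hrI] at hn h
  have h1 : 4 * C ^ 2 * I < r := lt_of_pow_lt_pow_left₀ I hrpos.le hn
  have h2 : r ≤ Real.pi / s * (2 * s ^ 2 + 1) :=
    le_of_pow_le_pow_left₀ hI.ne' (by positivity) h
  have hr16 : 16 < r := by linarith
  have hu4 : 4 < u := by
    have : (2 : ℝ) ^ (4 : ℝ) < 2 ^ u := by
      rw [← hr]; norm_num; exact hr16
    exact (Real.rpow_lt_rpow_left_iff (by norm_num)).1 this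
  have hur : 4 * u ≤ r := by
    have e : r = 16 * (2 : ℝ) ^ (u - 4) := by
      rw [Real.rpow_sub (by norm_num), ← hr]; norm_num; ring
    have h3 : 1 + (u - 4) / 2 ≤ (2 : ℝ) ^ (u - 4) := by
      rw [Real.rpow_def_of_pos (by norm_num)]
      have := Real.add_one_le_exp (Real.log 2 * (u - 4))
      have := Real.log_two_gt_d9
      nlinarith
    linarith
  have hs2 : 4 * s ^ 2 ≤ r ^ 2 / 16 := by
    have : 4 * s ^ 2 = (4 * C ^ 2 * I) * u / 4 := by
      rw [hsC, hu]; field_simp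
    rw [this]
    nlinarith
  have h3 : r ^ 2 ≤ Real.pi ^ 2 * (4 * s ^ 2 + 4 + 1 / s ^ 2) := by
    calc r ^ 2 ≤ (Real.pi / s * (2 * s ^ 2 + 1)) ^ 2 := by gcongr
      _ = _ := by field_simp; ring
  have h4 : 1 / s ^ 2 ≤ 1 / 4 := by
    apply one_div_le_one_div_of_le <;> linarith
  have h5 : Real.pi ^ 2 ≤ 10 := by
    nlinarith [Real.pi_lt_d2, Real.pi_pos]
  have h6 : r ^ 2 ≤ 10 * (r ^ 2 / 16 + 4 + 1 / 4) := by
    refine h3.trans ?_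
    gcongr
  nlinarith

lemma aux_collision {ι : Type*} [DecidableEq ι] (I : ℕ) (hI : 0 < I) (A : Fin I → ι → ℤ)
    (S : Finset ι) (C : ℤ) (hC : 1 ≤ C) (hA : ∀ i j, |A i j| ≤ C)
    (h : (4 * C ^ 2 * I) ^ I < 2 ^ S.card) :
    ∃ T ∈ S.powerset, ∃ T' ∈ S.powerset, T ≠ T' ∧ ∀ i, ∑ j ∈ T, A i j = ∑ j ∈ T', A i j := by
  have hI1 : (1 : ℤ) ≤ I := by exact_mod_cast hI
  by_cases hT : 4 ≤ C ^ 2 * I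
  · by_contra hcon
    push Not at hcon
    have hCr : (1 : ℝ) ≤ C := by exact_mod_cast hC
    have hn4 : 4 * I < S.card := by
      have : (2 : ℤ) ^ (4 * I) < 2 ^ S.card := by
        refine lt_of_le_of_lt ?_ h
        rw [pow_mul]
        gcongr
        linarith
      exact (pow_lt_pow_iff_right₀ (by norm_num)).1 this
    have hn4r : (4 : ℝ) * I < S.card := by exact_mod_cast hn4
    have hTr : (4 : ℝ) ≤ (C : ℝ) ^ 2 * I := by exact_mod_cast hT
    have hs2 : Real.sqrt (S.card * (C : ℝ) ^ 2 / 4) ^ 2 = S.card * (C : ℝ) ^ 2 / 4 :=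
      Real.sq_sqrt (by positivity)
    have h4 : (4 : ℝ) ≤ S.card * (C : ℝ) ^ 2 / 4 := by
      have : (4 * I : ℝ) * (C : ℝ) ^ 2 ≤ S.card * (C : ℝ) ^ 2 := by gcongr
      linarith
    have hs : 0 < Real.sqrt (S.card * (C : ℝ) ^ 2 / 4) := Real.sqrt_pos.2 (by linarith)
    refine aux_numeric I S.card hI C _ hs hs2 (by linarith) (by linarith)
      (by exact_mod_cast h) ?_
    refine aux_entropy I A S C (fun i j => by exact_mod_cast hA i j) _ hs (by linarith) hs2 ?_
    intro T hT T' hT' he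
    by_contra hne
    obtain ⟨i, hi⟩ := hcon T hT T' hT' hne
    exact hi (he i)
  · push Not at hT
    have hC1 : C = 1 := by nlinarith
    subst hC1
    have hI3 : I ≤ 3 := by
      have : (I : ℤ) < 4 := by linarith
      omega
    have key : ∀ m, m ≤ S.card → (m + 1) ^ I < 2 ^ m → 
        ∃ T ∈ S.powerset, ∃ T' ∈ S.powerset, T ≠ T' ∧
          ∀ i, ∑ j ∈ T, A i j = ∑ j ∈ T', A i j := by
      intro m hm hlt
      obtain ⟨S', hS', rfl⟩ := Finset.exists_subset_card_eq hm
      obtain ⟨T, hT, T', hT', h⟩ := aux_collision_range I A S' hA hlt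
      have hsub := Finset.powerset_mono.2 hS'
      exact ⟨T, hsub hT, T', hsub hT', h⟩
    have bound : ∀ m : ℕ, (2 : ℤ) ^ m ≤ (4 * 1 ^ 2 * I) ^ I → m < S.card := by
      intro m hm
      exact (pow_lt_pow_iff_right₀ (by norm_num)).1 (lt_of_le_of_lt hm h)
    interval_cases I
    · exact key 3 (bound 2 (by norm_num)) (by norm_num)
    · exact key 7 (bound 6 (by norm_num)) (by norm_num)
    · exact key 11 (bound 10 (by norm_num)) (by norm_num)

lemma aux_reduce {n I : ℕ} (A : Matrix (Fin I) (Fin n) ℤ) (x : Fin n → ℕ)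
    (T T' : Finset (Fin n)) (hT : ∀ j ∈ T, x j ≠ 0)
    (hne : (T \ T').Nonempty) (hT' : ∀ j ∈ T', x j ≠ 0)
    (h : ∀ i, ∑ j ∈ T, A i j = ∑ j ∈ T', A i j) :
    ∃ y : Fin n → ℕ, (∀ i, ∑ j, A i j * (y j : ℤ) = ∑ j, A i j * (x j : ℤ)) ∧
      (Finset.univ.filter (fun j => y j ≠ 0)).card <
        (Finset.univ.filter (fun j => x j ≠ 0)).card := by
  obtain ⟨k, hk, hmin⟩ := Finset.exists_min_image (T \ T') x hne
  let y : Fin n → ℕ := fun j =>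
    if j ∈ T then (if j ∈ T' then x j else x j - x k) else (if j ∈ T' then x j + x k else x j)
  have hy : ∀ j, (y j : ℤ) = x j - (if j ∈ T then (x k : ℤ) else 0)
      + (if j ∈ T' then (x k : ℤ) else 0) := by
    intro j
    simp only [y]
    by_cases h1 : j ∈ T <;> by_cases h2 : j ∈ T' <;> simp [h1, h2]
    have := hmin j (Finset.mem_sdiff.2 ⟨h1, h2⟩)
    omega
  refine ⟨y, fun i => ?_, ?_⟩
  · simp only [hy, mul_add, mul_sub, Finset.sum_add_distrib, Finset.sum_sub_distrib]
    simp only [mul_ite, mul_zero, Finset.sum_ite_mem, Finset.univ_inter, ← Finset.sum_mul, h i]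
    ring
  · apply Finset.card_lt_card
    rw [Finset.ssubset_iff_of_subset]
    · have hk' := Finset.mem_sdiff.1 hk
      exact ⟨k, by simp [hT k hk'.1], by simp [y, hk'.1, hk'.2]⟩
    · intro j hj
      simp only [Finset.mem_filter, Finset.mem_univ, true_and] at hj ⊢
      intro h0
      apply hj
      have h1 : j ∉ T := fun h => hT j h h0
      have h2 : j ∉ T' := fun h => hT' j h h0
      simp [y, h1, h2, h0]


/-- **Sparse solutions of integer linear inequality systems.**
If a system of `I` linear inequalities `A·x ≥ b` with integer coefficients,
all of absolute value at most `C` (with `C ≥ 1`), has a solution over `ℕ`,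
then it has a solution over `ℕ` with at most `2·I·log₂(2·C·√I)` non-zero unknowns. -/
theorem sparse_solution_of_linear_system
    (I n : ℕ) (hI : 0 < I) (hn : 0 < n)
    (A : Matrix (Fin I) (Fin n) ℤ) (b : Fin I → ℤ)
    (C : ℤ) (hC : 1 ≤ C)
    (hA : ∀ i j, |A i j| ≤ C) (hb : ∀ i, |b i| ≤ C)
    (x : Fin n → ℕ) (hx : ∀ i, b i ≤ ∑ j, A i j * (x j : ℤ)) :
    ∃ y : Fin n → ℕ,
      (∀ i, b i ≤ ∑ j, A i j * (y j : ℤ)) ∧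
      ((Finset.univ.filter (fun j => y j ≠ 0)).card : ℝ) ≤
        2 * I * Real.logb 2 (2 * C * Real.sqrt I) := by
  classical
  induction hm : (Finset.univ.filter (fun j => x j ≠ 0)).card using Nat.strong_induction_on
    generalizing x with
  | _ m ih =>
  by_cases hle : (m : ℝ) ≤ 2 * I * Real.logb 2 (2 * C * Real.sqrt I)
  · exact ⟨x, hx, by rw [hm]; exact hle⟩
  push Not at hle
  have hCr : (1 : ℝ) ≤ C := by exact_mod_cast hC
  have hIr : (0 : ℝ) < I := by exact_mod_cast hI
  have hlt : (4 * C ^ 2 * I) ^ I < (2 : ℤ) ^ m := by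
    have hz : 0 < 2 * (C : ℝ) * Real.sqrt I := by positivity
    have h1 : Real.logb 2 ((2 * C * Real.sqrt I) ^ (2 * I)) < m := by
      rw [Real.logb_pow]; push_cast; exact hle
    rw [Real.logb_lt_iff_lt_rpow (by norm_num) (by positivity), Real.rpow_natCast, pow_mul,
      mul_pow, Real.sq_sqrt hIr.le] at h1
    have e : (2 * (C : ℝ)) ^ 2 * I = 4 * C ^ 2 * I := by ring
    rw [e] at h1
    exact_mod_cast h1
  rw [← hm] at hlt
  obtain ⟨T, hT, T', hT', hne, heq⟩ := aux_collision I hI A _ C hC hA hlt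
  have hTx : ∀ j ∈ T, x j ≠ 0 := fun j hj =>
    (Finset.mem_filter.1 (Finset.mem_powerset.1 hT hj)).2
  have hTx' : ∀ j ∈ T', x j ≠ 0 := fun j hj =>
    (Finset.mem_filter.1 (Finset.mem_powerset.1 hT' hj)).2
  obtain ⟨y, hy, hcard⟩ : ∃ y : Fin n → ℕ,
      (∀ i, ∑ j, A i j * (y j : ℤ) = ∑ j, A i j * (x j : ℤ)) ∧
      (Finset.univ.filter (fun j => y j ≠ 0)).card <
        (Finset.univ.filter (fun j => x j ≠ 0)).card := by
    by_cases hTT : (T \ T').Nonempty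
    · exact aux_reduce A x T T' hTx hTT hTx' heq
    · refine aux_reduce A x T' T hTx' ?_ hTx (fun i => (heq i).symm)
      rw [Finset.not_nonempty_iff_eq_empty, Finset.sdiff_eq_empty_iff_subset] at hTT
      by_contra h2
      rw [Finset.not_nonempty_iff_eq_empty, Finset.sdiff_eq_empty_iff_subset] at h2
      exact hne (Finset.Subset.antisymm hTT h2)
  exact ih _ (hm ▸ hcard) y (fun i => by rw [hy i]; exact hx i) rfl
end

section
/- Let τ be a finite set of unary relation symbols and let φ = ⋀_{i=1}^{n} (Σ_{j=0}^{n_i} a_{i,j}·#x[φ_{i,j}]) ⋈_i b_i be a flat P¹ formula over τ, with indicators ind_{i,j}(π) = 1 if the atomic 1-type π logically implies φ_{i,j} and 0 otherwise. Then φ has a finite model if and only if there exists a family of natural numbers (x_π)_π indexed by the atomic 1-types over τ with Σ_π x_π ≥ 1 such that for every i, the integer Σ_{j=0}^{n_i} a_{i,j}·(Σ_π ind_{i,j}(π)·x_π) stands in relation ⋈_i to b_i. -/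
/-- One-variable formulas over a signature `τ` of unary relation symbols that
are free of counting terms: atoms `P(x)` combined with negation and conjunction. -/
inductive QF (τ : Type) : Type
  | atom : τ → QF τ
  | not : QF τ → QF τ
  | and : QF τ → QF τ → QF τ

/-- Satisfaction of a counting-term-free formula at an element of a structure. -/
def QF.sat {τ M : Type} (interp : τ → M → Bool) : QF τ → M → Bool
  | .atom P, a => interp P a
  | .not φ, a => !(φ.sat interp a)
  | .and φ ψ, a => φ.sat interp a && ψ.sat interp a

/-- Evaluation of a counting-term-free formula on an atomic 1-type `π : τ → Bool`;
`QF.evalType π φ = true` means that `π` logically implies `φ`. -/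
def QF.evalType {τ : Type} (π : τ → Bool) : QF τ → Bool
  | .atom P => π P
  | .not φ => !(φ.evalType π)
  | .and φ ψ => φ.evalType π && ψ.evalType π

/-- `charVec interp π` is `|π|_M`: the number of elements of the structure of
atomic 1-type `π`. -/
def charVec {τ M : Type} [Fintype τ] [DecidableEq τ] [Fintype M]
    (interp : τ → M → Bool) (π : τ → Bool) : ℕ :=
  (Finset.univ.filter (fun a : M => (fun P => interp P a) = π)).card

/-- The comparison symbols `⋈` allowed in a flat `P¹` formula:
`≤`, `≥`, or congruence modulo a positive integer `k`. -/
inductive Cmp : Type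
  | le : Cmp
  | ge : Cmp
  | mod : (k : ℕ) → 0 < k → Cmp

/-- `Cmp.holds c v b` expresses that the integer `v` stands in relation `c` to
the natural number `b`: `v ≤ b`, `v ≥ b`, or `v ≡ b (mod k)`. -/
def Cmp.holds : Cmp → ℤ → ℕ → Prop
  | .le, v, b => v ≤ (b : ℤ)
  | .ge, v, b => (b : ℤ) ≤ v
  | .mod k _, v, b => v % (k : ℤ) = (b : ℤ) % (k : ℤ)

/-- One conjunct `(Σ_j a_j·#x[φ_j]) ⋈ b` of a flat `P¹` formula: a list of pairs
of a non-zero integer coefficient and a counting-term-free formula, a comparison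
symbol, and a natural-number threshold.  A flat `P¹` formula is a list (i.e. a
finite conjunction) of such conjuncts. -/
structure FlatConjunct (τ : Type) where
  terms : List ({ a : ℤ // a ≠ 0 } × QF τ)
  cmp : Cmp
  bound : ℕ

/-- The value of the counting term `#x[φ]`: the number of elements satisfying `φ`. -/
def countSat {τ M : Type} [Fintype M] (interp : τ → M → Bool) (φ : QF τ) : ℕ :=
  (Finset.univ.filter (fun a : M => QF.sat interp φ a)).card

/-- Satisfaction of one flat conjunct in a finite structure. -/
def FlatConjunct.sat {τ M : Type} [Fintype M] (interp : τ → M → Bool)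
    (c : FlatConjunct τ) : Prop :=
  c.cmp.holds ((c.terms.map (fun p => p.1.1 * (countSat interp p.2 : ℤ))).sum) c.bound

/-- Satisfaction of a flat `P¹` formula (a conjunction of flat conjuncts). -/
def FlatSat {τ M : Type} [Fintype M] (interp : τ → M → Bool)
    (F : List (FlatConjunct τ)) : Prop :=
  ∀ c ∈ F, c.sat interp

theorem QF.sat_eq_evalType {τ M : Type} (interp : τ → M → Bool) (φ : QF τ) (a : M) :
    φ.sat interp a = φ.evalType (fun P => interp P a) := by
  induction φ with
  | atom P => rfl
  | not φ ih => simp [QF.sat, QF.evalType, ih]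
  | and φ ψ ih1 ih2 => simp [QF.sat, QF.evalType, ih1, ih2]

theorem countSat_eq_sum {τ M : Type} [Fintype τ] [DecidableEq τ] [Fintype M]
    (interp : τ → M → Bool) (φ : QF τ) :
    (countSat interp φ : ℤ) = ∑ π : τ → Bool,
      (if QF.evalType π φ then 1 else 0) * (charVec interp π : ℤ) := by
  have h : ∀ π : τ → Bool, (if QF.evalType π φ then 1 else 0) * (charVec interp π : ℤ)
      = ∑ a : M, if (fun P => interp P a) = π then
          (if QF.evalType π φ then (1 : ℤ) else 0) else 0 := by
    intro π
    rw [charVec, Finset.card_filter]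
    push_cast
    rw [Finset.mul_sum]
    refine Finset.sum_congr rfl fun a _ => ?_
    split_ifs <;> simp
  simp_rw [h]
  rw [Finset.sum_comm, countSat, Finset.card_filter]
  push_cast
  refine Finset.sum_congr rfl fun a _ => ?_
  rw [Finset.sum_ite_eq, QF.sat_eq_evalType]
  simp

theorem sum_charVec {τ M : Type} [Fintype τ] [DecidableEq τ] [Fintype M]
    (interp : τ → M → Bool) : ∑ π : τ → Bool, charVec interp π = Fintype.card M := by
  unfold charVec
  exact (Finset.card_eq_sum_card_fiberwise (s := Finset.univ) (t := Finset.univ)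
    (f := fun (a : M) => (fun P => interp P a)) (fun _ _ => by simp)).symm

theorem charVec_sigma {τ : Type} [Fintype τ] [DecidableEq τ] (x : (τ → Bool) → ℕ)
    (π : τ → Bool) :
    charVec (M := Σ π : τ → Bool, Fin (x π)) (fun P a => a.1 P) π = x π := by
  unfold charVec
  rw [Finset.card_filter, Fintype.sum_sigma, Finset.sum_eq_single π]
  · simp
  · intro ρ _ hρ
    exact Finset.sum_eq_zero fun a _ => if_neg hρ
  · simp

/-- A flat `P¹` formula `⋀_i (Σ_j a_{i,j}·#x[φ_{i,j}]) ⋈_i b_i` has a finite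
model (holds in some finite nonempty structure) if and only if the associated
system of inequalities and congruences has a solution: there is a family of
natural numbers `(x_π)_π` indexed by the atomic 1-types with `Σ_π x_π ≥ 1` such
that for every `i` the integer `Σ_j a_{i,j}·(Σ_π ind_{i,j}(π)·x_π)` stands in
relation `⋈_i` to `b_i`, where `ind_{i,j}(π)` is the indicator of whether `π`
logically implies `φ_{i,j}`. -/
theorem flat_finitely_satisfiable_iff_system_solvable
    {τ : Type} [Fintype τ] [DecidableEq τ] (F : List (FlatConjunct τ)) :
    (∃ (M : Type) (instM : Fintype M), Nonempty M ∧
        ∃ interp : τ → M → Bool, @FlatSat τ M instM interp F) ↔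
      ∃ x : (τ → Bool) → ℕ, (1 ≤ ∑ π : τ → Bool, x π) ∧
        ∀ c ∈ F, c.cmp.holds
          ((c.terms.map (fun p => p.1.1 *
            (∑ π : τ → Bool,
              (if QF.evalType π p.2 then 1 else 0) * (x π : ℤ)))).sum)
          c.bound := by
  constructor
  · rintro ⟨M, instM, hM, interp, h⟩
    refine ⟨charVec interp, ?_, fun c hc => ?_⟩
    · rw [sum_charVec]
      exact Fintype.card_pos
    · have := h c hc
      unfold FlatConjunct.sat at this
      simpa only [countSat_eq_sum] using this
  · rintro ⟨x, hx, h⟩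
    have hs := sum_charVec (M := Σ π : τ → Bool, Fin (x π)) (fun P a => a.1 P)
    simp only [charVec_sigma] at hs
    refine ⟨Σ π : τ → Bool, Fin (x π), inferInstance, ?_, fun P a => a.1 P, fun c hc => ?_⟩
    · rw [← Fintype.card_pos_iff]
      omega
    · unfold FlatConjunct.sat
      simpa only [countSat_eq_sum, charVec_sigma] using h c hc
end
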